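/- arXiv:2307.14887 — 2 statements merged into one kernel-verified Lean document; each statement's English description precedes it below -/
import Mathlib

section
/- (Representation of the value function as a mixture of hockey-stick functions.) For every fixed s ∈ (0,∞)ᵈ and every k ∈ {0, 1, …, N}, there exists a probability measure μ on [0,∞) (depending on s and k) such that V_k(y, s) = ∫_{[0,∞)} max(|y|, z) dμ(z) for all y ∈ ℝ. -/
open MeasureTheory ProbabilityTheory Real Filter

noncomputable section

/-- The standard normal cumulative distribution function `Φ`. -/
def stdNormalCDF (x : ℝ) : ℝ := ((gaussianReal 0 1) (Set.Iic x)).toReal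

/-- The law of `d` i.i.d. standard normal random variables. -/
def stdGaussianPi (d : ℕ) : Measure (Fin d → ℝ) := Measure.pi fun _ => gaussianReal 0 1

/-- Next-period (discounted) prices in the uncorrelated Black-Scholes market:
given current prices `s`, volatilities `σ`, time increment `Δt` and Gaussian noise `ω`,
the next price of asset `i` is `sⁱ · exp(−(σⁱ)²Δt/2 + σⁱ√Δt · ωⁱ)`. -/
def nextPrice (d : ℕ) (σ : Fin d → ℝ) (Δt : ℝ) (s ω : Fin d → ℝ) : Fin d → ℝ :=
  fun i => s i * Real.exp (-(σ i) ^ 2 * Δt / 2 + σ i * Real.sqrt Δt * ω i)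

/-- The coefficient `±1` of a signed unit-vector action in `◇ = {±e_i}`:
an action is a pair `(i, b) : Fin d × Bool`, representing `e_i` if `b` and `−e_i` otherwise. -/
def actionCoeff (b : Bool) : ℝ := if b then 1 else -1

/-- `passportValue d σ Δt N m x s` is the value function `V_{N−m}(x, s)` of the discrete-time
passport option pricing problem, defined backward in time by `V_N(x,s) = |x|` and
`V_k(x,s) = max_{q ∈ ◇} E[V_{k+1}(x + Σ_j qʲ(Sʲ − sʲ), S)]`, where `S` is the vector of
next-period prices given current prices `s` and the step from `k` to `k+1` uses the
time increment `Δt (k+1)`. Here `m` is the number of remaining steps. -/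
def passportValue (d : ℕ) (σ : Fin d → ℝ) (Δt : ℕ → ℝ) (N : ℕ) : ℕ → ℝ → (Fin d → ℝ) → ℝ
  | 0 => fun x _ => |x|
  | (m + 1) => fun x s =>
      ⨆ a : Fin d × Bool,
        ∫ ω, passportValue d σ Δt N m
            (x + actionCoeff a.2 * (nextPrice d σ (Δt (N - m)) s ω a.1 - s a.1))
            (nextPrice d σ (Δt (N - m)) s ω) ∂(stdGaussianPi d)

open scoped Topology

theorem hockey_stick_mixture (f : ℝ → ℝ) (hf : ConvexOn ℝ Set.univ f) (heven : ∀ x, f (-x) = f x)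
    (hlim : Tendsto (fun x => f x - x) atTop (𝓝 0)) :
    ∃ μ : Measure ℝ, IsProbabilityMeasure μ ∧ μ (Set.Iio 0) = 0 ∧
      ∀ y : ℝ, f y = ∫ z, max |y| z ∂μ := by
  have hcont : Continuous f := by
    rw [← continuousOn_univ]; exact hf.continuousOn isOpen_univ
  set r : ℝ → ℝ := fun x => derivWithin f (Set.Ioi x) x with hr
  have hrd : ∀ x, HasDerivWithinAt f (r x) (Set.Ioi x) x := fun x =>
    hf.hasDerivWithinAt_rightDeriv_of_mem_interior (by simp)
  have hrmono : Monotone r := by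
    have := hf.monotoneOn_rightDeriv
    rwa [interior_univ, monotoneOn_univ] at this
  have hrup : ∀ x, r x ≤ f (x + 1) - f x := by
    intro x
    have := hf.le_slope_of_hasDerivWithinAt_Ioi (Set.mem_univ x) (Set.mem_univ (x+1)) (by linarith)
      (hrd x)
    simpa [slope_def_field] using this
  have hrlow : ∀ x, f x - f (x - 1) ≤ r x := by
    intro x
    have h1 : Tendsto (slope f x) (𝓝[>] x) (𝓝 (r x)) :=
      (hasDerivWithinAt_iff_tendsto_slope' (by simp)).mp (hrd x)
    refine ge_of_tendsto h1 ?_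
    filter_upwards [self_mem_nhdsWithin] with y hy
    have := hf.slope_mono_adjacent (Set.mem_univ (x-1)) (Set.mem_univ y) (y := x) (by linarith) hy
    rw [slope_def_field]
    simpa using this
  have hd1 : Tendsto (fun x => f (x + 1) - f x) atTop (𝓝 1) := by
    have h1 : Tendsto (fun x : ℝ => f (x+1) - (x+1)) atTop (𝓝 0) :=
      hlim.comp (tendsto_atTop_add_const_right _ 1 tendsto_id)
    have := (h1.sub hlim).add_const 1
    simp only [sub_zero, zero_add] at this
    exact this.congr (fun x => by ring)
  have hd2 : Tendsto (fun x => f x - f (x - 1)) atTop (𝓝 1) := by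
    have h1 : Tendsto (fun x : ℝ => f (x-1) - (x-1)) atTop (𝓝 0) :=
      hlim.comp (tendsto_atTop_add_const_right _ (-1) tendsto_id)
    have := (hlim.sub h1).add_const 1
    simp only [sub_zero, zero_add] at this
    exact this.congr (fun x => by ring)
  have hrlim : Tendsto r atTop (𝓝 1) := tendsto_of_tendsto_of_tendsto_of_le_of_le hd2 hd1 hrlow hrup
  have hr1 : ∀ x, r x ≤ 1 := fun x => hrmono.ge_of_tendsto hrlim x
  have hr0 : 0 ≤ r 0 := by
    have h1 : Tendsto (slope f 0) (𝓝[>] 0) (𝓝 (r 0)) :=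
      (hasDerivWithinAt_iff_tendsto_slope' (by simp)).mp (hrd 0)
    refine ge_of_tendsto h1 ?_
    filter_upwards [self_mem_nhdsWithin] with y hy
    have hy : 0 < y := hy
    rw [slope_def_field]
    have h2 := hf.2 (Set.mem_univ y) (Set.mem_univ (-y)) (show (0:ℝ) ≤ 1/2 by norm_num) (show (0:ℝ) ≤ 1/2 by norm_num)
      (by norm_num)
    simp only [smul_eq_mul, heven] at h2
    have h3 : (1/2 * y + 1/2 * -y) = 0 := by ring
    rw [h3] at h2
    apply div_nonneg <;> linarith
  set q : ℝ → ℝ := fun x => if x < 0 then 0 else r x with hq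
  have hqnn : ∀ x, 0 ≤ q x := by
    intro x; simp only [hq]; split_ifs with h
    · exact le_rfl
    · exact hr0.trans (hrmono (not_lt.mp h))
  have hqmono : Monotone q := by
    intro x y hxy
    by_cases h : x < 0
    · simp only [hq, if_pos h]; exact hqnn y
    · have : ¬ y < 0 := by linarith
      simp only [hq, if_neg h, if_neg this]; exact hrmono hxy
  have hqlim : Tendsto q atTop (𝓝 1) := by
    refine hrlim.congr' ?_
    filter_upwards [eventually_ge_atTop 0] with x hx
    simp [hq, not_lt.mpr hx]
  set F := hqmono.stieltjesFunction with hF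
  have hFge : ∀ x, q x ≤ F x := fun x => by
    rw [hF, hqmono.stieltjesFunction_eq]; exact hqmono.le_rightLim le_rfl
  have hFle : ∀ x y, x < y → F x ≤ q y := fun x y h => by
    rw [hF, hqmono.stieltjesFunction_eq]; exact hqmono.rightLim_le h
  have hFneg : ∀ x, x < 0 → F x = 0 := fun x h => by
    refine le_antisymm ?_ ((hqnn x).trans (hFge x))
    refine (hFle x (x/2) (by linarith)).trans ?_
    simp [hq, show x/2 < 0 by linarith]
  have hFtop : Tendsto F atTop (𝓝 1) := by
    refine tendsto_of_tendsto_of_tendsto_of_le_of_le hqlim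
      (hqlim.comp (tendsto_atTop_add_const_right _ 1 tendsto_id)) hFge ?_
    intro x; exact hFle x (x+1) (by linarith)
  have hFbot : Tendsto F atBot (𝓝 0) := by
    refine tendsto_const_nhds.congr' ?_
    filter_upwards [eventually_lt_atBot 0] with x hx
    exact (hFneg x hx).symm
  have hP : IsProbabilityMeasure F.measure := F.isProbabilityMeasure hFbot hFtop
  refine ⟨F.measure, hP, ?_, ?_⟩
  · rw [F.measure_Iio hFbot]
    have : Function.leftLim F 0 ≤ 0 := by
      have h1 := F.mono.tendsto_leftLim 0
      refine le_of_tendsto h1 ?_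
      filter_upwards [self_mem_nhdsWithin] with x hx
      exact (hFneg x hx).le
    simpa using this
  intro y
  have hfy : f y = f |y| := by
    rcases abs_choice y with h | h <;> rw [h]
    exact (heven y).symm
  rw [hfy]
  have hy := abs_nonneg y
  generalize |y| = y at hy
  -- FTC
  have hgd : ∀ t, HasDerivWithinAt (fun t => (y + t) - f (y + t)) (1 - r (y + t)) (Set.Ioi t) t := by
    intro t
    have h0 : HasDerivWithinAt (fun t : ℝ => y + t) 1 (Set.Ioi t) t :=
      ((hasDerivAt_id t).const_add y).hasDerivWithinAt
    have h1 := (hrd (y + t)).comp t h0 (fun z hz => by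
      simp only [Set.mem_Ioi] at hz ⊢; linarith)
    have h2 := h0.sub h1
    rw [mul_one] at h2
    exact h2
  have hanti : Antitone (fun t => 1 - r (y + t)) := fun a b hab => by
    have := hrmono (show y + a ≤ y + b by linarith)
    simp only; linarith
  have hint : ∀ a b, IntervalIntegrable (fun t => 1 - r (y + t)) volume a b :=
    fun a b => hanti.intervalIntegrable
  have hnn : ∀ t, 0 ≤ 1 - r (y + t) := fun t => by linarith [hr1 (y+t)]
  have hftc : ∀ b, ∫ t in (0:ℝ)..b, (1 - r (y + t)) = (y + b - f (y + b)) - (y - f y) := by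
    intro b
    have := intervalIntegral.integral_eq_sub_of_hasDeriv_right
      (f := fun t => (y + t) - f (y + t)) (a := 0) (b := b)
      (by fun_prop) (fun t _ => hgd t) (hint 0 b)
    simpa using this
  have htend : Tendsto (fun b => ∫ t in (0:ℝ)..b, (1 - r (y + t))) atTop (𝓝 (f y - y)) := by
    simp only [hftc]
    have h1 : Tendsto (fun b : ℝ => f (y + b) - (y + b)) atTop (𝓝 0) :=
      hlim.comp (tendsto_atTop_add_const_left _ y tendsto_id)
    have := h1.neg.sub_const (y - f y)
    simp only [neg_zero, zero_sub, neg_sub] at this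
    exact this
  have hIoi : IntegrableOn (fun t => 1 - r (y + t)) (Set.Ioi 0) := by
    refine integrableOn_Ioi_of_intervalIntegral_norm_tendsto (f y - y) 0 (l := atTop)
      (b := fun x : ℝ => x) (fun i => (hint 0 i).1) tendsto_id ?_
    simpa only [Real.norm_of_nonneg (hnn _)] using htend
  have hval : ∫ t in Set.Ioi 0, (1 - r (y + t)) = f y - y :=
    tendsto_nhds_unique (intervalIntegral_tendsto_integral_Ioi 0 hIoi tendsto_id) htend
  have hfyy : 0 ≤ f y - y := by rw [← hval]; exact integral_nonneg hnn
  -- layer cake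
  have hmnn : 0 ≤ᵐ[F.measure] fun z => max (z - y) 0 :=
    Eventually.of_forall fun z => le_max_right (z - y) 0
  have hae : ∀ᵐ t ∂(volume.restrict (Set.Ioi (0:ℝ))),
      F.measure {z | t < max (z - y) 0} = ENNReal.ofReal (1 - r (y + t)) := by
    have hc : ({t | ¬ ContinuousAt q (y + t)} : Set ℝ).Countable :=
      hqmono.countable_not_continuousAt.preimage_of_injOn
        (f := fun t => y + t) (fun a _ b _ h => by simpa using h)
    have h1 := ae_restrict_of_ae (s := Set.Ioi (0:ℝ)) (hc.ae_notMem volume)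
    filter_upwards [h1, ae_restrict_mem measurableSet_Ioi] with t ht ht0
    have ht0 : 0 < t := ht0
    have ht : ContinuousAt q (y + t) := not_not.mp ht
    have hset : {z | t < max (z - y) 0} = Set.Ioi (y + t) := by
      ext z
      simp only [Set.mem_ofPred_eq, lt_max_iff, Set.mem_Ioi]
      constructor
      · rintro (h | h) <;> linarith
      · intro h; left; linarith
    rw [hset, F.measure_Ioi hFtop]
    have : F (y + t) = r (y + t) := by
      rw [hF, hqmono.stieltjesFunction_eq, ht.continuousWithinAt.rightLim_eq]
      simp [hq, not_lt.mpr (show 0 ≤ y + t by linarith)]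
    rw [this]
  have hlint : ∫⁻ z, ENNReal.ofReal (max (z - y) 0) ∂F.measure = ENNReal.ofReal (f y - y) := by
    rw [lintegral_eq_lintegral_meas_lt F.measure hmnn
      (by fun_prop), lintegral_congr_ae hae, ← hval,
      ofReal_integral_eq_lintegral_ofReal hIoi (Eventually.of_forall hnn)]
  have hi : Integrable (fun z => max (z - y) 0) F.measure := by
    refine ⟨by fun_prop, ?_⟩
    rw [hasFiniteIntegral_iff_ofReal hmnn, hlint]
    exact ENNReal.ofReal_lt_top
  have hI : ∫ z, max (z - y) 0 ∂F.measure = f y - y := by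
    rw [integral_eq_lintegral_of_nonneg_ae hmnn
      (by fun_prop), hlint, ENNReal.toReal_ofReal hfyy]
  have : ∀ z, max y z = y + max (z - y) 0 := fun z => by
    rcases le_total y z with h | h
    · rw [max_eq_right h, max_eq_left (by linarith)]; ring
    · rw [max_eq_left h, max_eq_right (by linarith)]; ring
  simp_rw [this]
  rw [integral_add (integrable_const _) hi, hI]
  simp

instance instProbStdGaussianPi (d : ℕ) : IsProbabilityMeasure (stdGaussianPi d) := by
  unfold stdGaussianPi; infer_instance

theorem integrable_nextPrice (d : ℕ) (σ : Fin d → ℝ) (Δ : ℝ) (s : Fin d → ℝ)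
    (i : Fin d) : Integrable (fun ω => nextPrice d σ Δ s ω i) (stdGaussianPi d) := by
  have h : Integrable (fun x : ℝ => Real.exp (σ i * Real.sqrt Δ * x)) (gaussianReal 0 1) :=
    integrable_exp_mul_gaussianReal _
  have h2 := (h.const_mul (s i * Real.exp (-(σ i) ^ 2 * Δ / 2)))
  have h3 := (measurePreserving_eval (fun _ : Fin d => gaussianReal 0 1) i).integrable_comp_of_integrable h2
  refine h3.congr (Eventually.of_forall fun ω => ?_)
  simp only [Function.comp, nextPrice, Function.eval, Real.exp_add]
  ring

theorem integral_nextPrice (d : ℕ) (σ : Fin d → ℝ) (Δ : ℝ) (hΔ : 0 < Δ) (s : Fin d → ℝ)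
    (i : Fin d) : ∫ ω, nextPrice d σ Δ s ω i ∂(stdGaussianPi d) = s i := by
  have h1 : ∫ x, Real.exp (σ i * Real.sqrt Δ * x) ∂(gaussianReal 0 1)
      = Real.exp ((σ i) ^ 2 * Δ / 2) := by
    have := congrFun (mgf_id_gaussianReal (μ := 0) (v := 1)) (σ i * Real.sqrt Δ)
    simp only [mgf, id] at this
    rw [this]
    congr 1
    rw [mul_pow, Real.sq_sqrt hΔ.le]; simp
  have h3 := (measurePreserving_eval (fun _ : Fin d => gaussianReal 0 1) i)
  have h4 : ∫ ω, Real.exp (σ i * Real.sqrt Δ * ω i) ∂(stdGaussianPi d)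
      = Real.exp ((σ i) ^ 2 * Δ / 2) := by
    rw [← h1, ← h3.map_eq, integral_map h3.measurable.aemeasurable (by fun_prop)]
    rfl
  simp only [nextPrice, Real.exp_add]
  rw [integral_const_mul, integral_const_mul, h4, ← Real.exp_add]
  have : -(σ i) ^ 2 * Δ / 2 + (σ i) ^ 2 * Δ / 2 = 0 := by ring
  rw [this]; simp

theorem abs_nextPrice (d : ℕ) (σ : Fin d → ℝ) (Δ : ℝ) (s ω : Fin d → ℝ)
    (i : Fin d) : |nextPrice d σ Δ s ω i| = nextPrice d σ Δ (fun i => |s i|) ω i := by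
  simp only [nextPrice, abs_mul, Real.abs_exp]

/-- The inductive invariant. -/
structure GoodValue (d : ℕ) (V : ℝ → (Fin d → ℝ) → ℝ) (C : ℝ) : Prop where
  meas : Measurable (fun p : ℝ × (Fin d → ℝ) => V p.1 p.2)
  lower : ∀ x s, |x| ≤ V x s
  upper : ∀ x s, V x s ≤ |x| + C * ∑ i, |s i|
  even : ∀ x s, V (-x) s = V x s
  conv : ∀ s, ConvexOn ℝ Set.univ (fun x => V x s)
  lim : ∀ s, Tendsto (fun x => V x s - x) atTop (𝓝 0)

theorem GoodValue.step {d : ℕ} (hd : 0 < d) {V : ℝ → (Fin d → ℝ) → ℝ} {C : ℝ}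
    (hV : GoodValue d V C) (σ : Fin d → ℝ) (Δ : ℝ) (hΔ : 0 < Δ) :
    GoodValue d (fun x s => ⨆ a : Fin d × Bool,
        ∫ ω, V (x + actionCoeff a.2 * (nextPrice d σ Δ s ω a.1 - s a.1))
            (nextPrice d σ Δ s ω) ∂(stdGaussianPi d)) (C + 2) := by
  have : Nonempty (Fin d) := ⟨⟨0, hd⟩⟩
  have hmN : Measurable (fun p : (Fin d → ℝ) × (Fin d → ℝ) => nextPrice d σ Δ p.1 p.2) := by
    unfold nextPrice; fun_prop
  have hmNs : ∀ s, Measurable (fun ω : Fin d → ℝ => nextPrice d σ Δ s ω) := fun s => by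
    unfold nextPrice; fun_prop
  have hq : ∀ b, |actionCoeff b| = 1 := fun b => by cases b <;> simp [actionCoeff]
  -- the increment
  have hDint : ∀ s (a : Fin d × Bool), Integrable (fun ω =>
      actionCoeff a.2 * (nextPrice d σ Δ s ω a.1 - s a.1)) (stdGaussianPi d) := fun s a =>
    ((integrable_nextPrice d σ Δ s a.1).sub (integrable_const _)).const_mul _
  have hDzero : ∀ s (a : Fin d × Bool), ∫ ω,
      actionCoeff a.2 * (nextPrice d σ Δ s ω a.1 - s a.1) ∂(stdGaussianPi d) = 0 := fun s a => by
    rw [integral_const_mul, integral_sub (integrable_nextPrice d σ Δ s a.1) (integrable_const _),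
      integral_nextPrice d σ Δ hΔ]
    simp
  have hSint : ∀ s, Integrable (fun ω => ∑ i, |nextPrice d σ Δ s ω i|) (stdGaussianPi d) :=
    fun s => integrable_finsetSum _ fun i _ => (integrable_nextPrice d σ Δ s i).abs
  have hSval : ∀ s, ∫ ω, ∑ i, |nextPrice d σ Δ s ω i| ∂(stdGaussianPi d) = ∑ i, |s i| := fun s => by
    rw [integral_finsetSum _ fun i _ => (integrable_nextPrice d σ Δ s i).abs]
    refine Finset.sum_congr rfl fun i _ => ?_
    simp_rw [abs_nextPrice]
    exact integral_nextPrice d σ Δ hΔ _ i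
  have hDabs : ∀ s (a : Fin d × Bool), ∫ ω,
      |actionCoeff a.2 * (nextPrice d σ Δ s ω a.1 - s a.1)| ∂(stdGaussianPi d) ≤ 2 * ∑ i, |s i| := by
    intro s a
    have h1 : ∫ ω, |actionCoeff a.2 * (nextPrice d σ Δ s ω a.1 - s a.1)| ∂(stdGaussianPi d)
        ≤ ∫ ω, (|nextPrice d σ Δ s ω a.1| + |s a.1|) ∂(stdGaussianPi d) := by
      refine integral_mono (hDint s a).abs
        ((integrable_nextPrice d σ Δ s a.1).abs.add (integrable_const _)) fun ω => ?_
      simp only [abs_mul, hq, one_mul]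
      exact abs_sub _ _
    have h2 : ∫ ω, (|nextPrice d σ Δ s ω a.1| + |s a.1|) ∂(stdGaussianPi d) = 2 * |s a.1| := by
      rw [integral_add (integrable_nextPrice d σ Δ s a.1).abs (integrable_const _)]
      simp_rw [abs_nextPrice]
      rw [integral_nextPrice d σ Δ hΔ]
      simp; ring
    have h3 : |s a.1| ≤ ∑ i, |s i| :=
      Finset.single_le_sum (f := fun i => |s i|) (fun i _ => abs_nonneg _) (Finset.mem_univ _)
    linarith
  set I : Fin d × Bool → ℝ → (Fin d → ℝ) → ℝ := fun a x s =>
    ∫ ω, V (x + actionCoeff a.2 * (nextPrice d σ Δ s ω a.1 - s a.1))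
            (nextPrice d σ Δ s ω) ∂(stdGaussianPi d) with hI
  have hmω : ∀ (a : Fin d × Bool) (x : ℝ) (s : Fin d → ℝ), Measurable (fun ω : Fin d → ℝ =>
      V (x + actionCoeff a.2 * (nextPrice d σ Δ s ω a.1 - s a.1)) (nextPrice d σ Δ s ω)) := by
    intro a x s
    refine hV.meas.comp (Measurable.prodMk ?_ (hmNs s))
    have := (measurable_pi_apply a.1).comp (hmNs s)
    exact ((this.sub_const _).const_mul _).const_add _
  have hint : ∀ (a : Fin d × Bool) (x : ℝ) (s : Fin d → ℝ), Integrable (fun ω =>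
      V (x + actionCoeff a.2 * (nextPrice d σ Δ s ω a.1 - s a.1)) (nextPrice d σ Δ s ω))
      (stdGaussianPi d) := by
    intro a x s
    refine Integrable.mono' (((integrable_const x).add (hDint s a)).abs.add ((hSint s).const_mul C))
      (hmω a x s).aestronglyMeasurable (Eventually.of_forall fun ω => ?_)
    rw [Real.norm_of_nonneg ((abs_nonneg _).trans (hV.lower _ _))]
    exact hV.upper _ _
  have hIlow : ∀ a x s, |x| ≤ I a x s := by
    intro a x s
    calc |x| = |∫ ω, (x + actionCoeff a.2 * (nextPrice d σ Δ s ω a.1 - s a.1)) ∂(stdGaussianPi d)| := by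
          rw [integral_add (integrable_const _) (hDint s a), hDzero]; simp
      _ ≤ ∫ ω, |x + actionCoeff a.2 * (nextPrice d σ Δ s ω a.1 - s a.1)| ∂(stdGaussianPi d) :=
          abs_integral_le_integral_abs
      _ ≤ I a x s := integral_mono ((integrable_const x).add (hDint s a)).abs (hint a x s)
          fun ω => hV.lower _ _
  have hIup : ∀ a x s, I a x s ≤ |x| + (C + 2) * ∑ i, |s i| := by
    intro a x s
    have h1 : I a x s ≤ ∫ ω, ((|x| + |actionCoeff a.2 * (nextPrice d σ Δ s ω a.1 - s a.1)|)
        + C * ∑ i, |nextPrice d σ Δ s ω i|) ∂(stdGaussianPi d) := by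
      refine integral_mono (hint a x s)
        (((integrable_const _).add (hDint s a).abs).add ((hSint s).const_mul C)) fun ω => ?_
      have := abs_add_le x (actionCoeff a.2 * (nextPrice d σ Δ s ω a.1 - s a.1))
      have h2 := hV.upper (x + actionCoeff a.2 * (nextPrice d σ Δ s ω a.1 - s a.1))
        (nextPrice d σ Δ s ω)
      simp only
      linarith
    have hsum : Integrable (fun ω => |x| +
        |actionCoeff a.2 * (nextPrice d σ Δ s ω a.1 - s a.1)|) (stdGaussianPi d) :=
      (integrable_const _).add (hDint s a).abs
    rw [integral_add hsum ((hSint s).const_mul C),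
      integral_add (integrable_const _) (hDint s a).abs, integral_const_mul, hSval] at h1
    simp only [integral_const, probReal_univ, smul_eq_mul, one_mul] at h1
    have := hDabs s a
    linarith
  have hIeven : ∀ i b x s, I (i, b) (-x) s = I (i, !b) x s := by
    intro i b x s
    simp only [hI]
    congr 1; funext ω
    rw [← hV.even]
    congr 1
    cases b <;> simp [actionCoeff] <;> ring
  have hIconv : ∀ a s, ConvexOn ℝ Set.univ (fun x => I a x s) := by
    intro a s
    refine ⟨convex_univ, fun x _ y _ p r hp hr hpr => ?_⟩
    simp only [smul_eq_mul, hI]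
    rw [← integral_const_mul, ← integral_const_mul,
      ← integral_add ((hint a x s).const_mul p) ((hint a y s).const_mul r)]
    refine integral_mono (hint a _ s) (((hint a x s).const_mul p).add ((hint a y s).const_mul r))
      fun ω => ?_
    generalize actionCoeff a.2 * (nextPrice d σ Δ s ω a.1 - s a.1) = D
    have := (hV.conv (nextPrice d σ Δ s ω)).2 (Set.mem_univ (x + D)) (Set.mem_univ (y + D))
      hp hr hpr
    simp only [smul_eq_mul] at this
    convert this using 2
    have : D = p * D + r * D := by rw [← add_mul, hpr, one_mul]
    linear_combination this
  have hIlim : ∀ a s, Tendsto (fun x => I a x s - x) atTop (𝓝 0) := by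
    intro a s
    have heq : ∀ x, I a x s - x = ∫ ω, (V (x + actionCoeff a.2 * (nextPrice d σ Δ s ω a.1 - s a.1))
        (nextPrice d σ Δ s ω) - x) ∂(stdGaussianPi d) := fun x => by
      rw [integral_sub (hint a x s) (integrable_const _)]; simp [hI]
    rw [← hDzero s a]
    have h0 : ∀ᶠ x : ℝ in atTop, I a x s - x = ∫ ω, (V (x + actionCoeff a.2 * (nextPrice d σ Δ s ω a.1 - s a.1))
        (nextPrice d σ Δ s ω) - x) ∂(stdGaussianPi d) := Eventually.of_forall heq
    refine Tendsto.congr' (h0.mono fun x hx => hx.symm) ?_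
    refine tendsto_integral_filter_of_dominated_convergence
      (fun ω => |actionCoeff a.2 * (nextPrice d σ Δ s ω a.1 - s a.1)|
        + C * ∑ i, |nextPrice d σ Δ s ω i|) ?_ ?_ ?_ ?_
    · exact Eventually.of_forall fun x => ((hmω a x s).sub_const _).aestronglyMeasurable
    · filter_upwards [eventually_ge_atTop 0] with x hx
      refine Eventually.of_forall fun ω => ?_
      generalize actionCoeff a.2 * (nextPrice d σ Δ s ω a.1 - s a.1) = D
      have h1 := hV.lower (x + D) (nextPrice d σ Δ s ω)
      have h2 := hV.upper (x + D) (nextPrice d σ Δ s ω)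
      have h3 := abs_add_le x D
      have h4 := abs_of_nonneg hx
      have h5 := le_abs_self (x + D)
      have h6 := neg_abs_le D
      rw [Real.norm_eq_abs, abs_le]
      constructor <;> linarith
    · exact (hDint s a).abs.add ((hSint s).const_mul C)
    · refine Eventually.of_forall fun ω => ?_
      generalize actionCoeff a.2 * (nextPrice d σ Δ s ω a.1 - s a.1) = D
      have h1 : Tendsto (fun x : ℝ => V (x + D) (nextPrice d σ Δ s ω) - (x + D)) atTop (𝓝 0) :=
        (hV.lim (nextPrice d σ Δ s ω)).comp (tendsto_atTop_add_const_right _ D tendsto_id)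
      have h2 := h1.add_const D
      rw [zero_add] at h2
      exact h2.congr fun x => by ring
  have hbdd : ∀ x s, BddAbove (Set.range fun a => I a x s) := fun x s => Set.finite_range _ |>.bddAbove
  refine ⟨?_, ?_, ?_, ?_, ?_, ?_⟩
  · refine Measurable.iSup fun a => ?_
    have : StronglyMeasurable (fun z : (ℝ × (Fin d → ℝ)) × (Fin d → ℝ) =>
        V (z.1.1 + actionCoeff a.2 * (nextPrice d σ Δ z.1.2 z.2 a.1 - z.1.2 a.1))
            (nextPrice d σ Δ z.1.2 z.2)) := by
      apply Measurable.stronglyMeasurable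
      have h1 : Measurable (fun z : (ℝ × (Fin d → ℝ)) × (Fin d → ℝ) =>
          nextPrice d σ Δ z.1.2 z.2) :=
        hmN.comp ((measurable_snd.comp measurable_fst).prodMk measurable_snd)
      refine hV.meas.comp (Measurable.prodMk ?_ h1)
      have := (measurable_pi_apply a.1).comp h1
      have h2 : Measurable (fun z : (ℝ × (Fin d → ℝ)) × (Fin d → ℝ) => z.1.2 a.1) := by fun_prop
      exact (measurable_fst.comp measurable_fst).add ((this.sub h2).const_mul _)
    exact (this.integral_prod_right' (ν := stdGaussianPi d)).measurable
  · intro x s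
    exact (hIlow (Classical.arbitrary _) x s).trans (le_ciSup (hbdd x s) (Classical.arbitrary _))
  · intro x s
    exact ciSup_le fun a => hIup a x s
  · intro x s
    change (⨆ a, I a (-x) s) = ⨆ a, I a x s
    refine le_antisymm (ciSup_le fun a => ?_) (ciSup_le fun a => ?_)
    · rw [show a = (a.1, a.2) from rfl, hIeven]
      exact le_ciSup (hbdd x s) (a.1, !a.2)
    · have := hIeven a.1 (!a.2) x s
      rw [Bool.not_not] at this
      rw [show a = (a.1, a.2) from rfl, ← this]
      exact le_ciSup (hbdd (-x) s) (a.1, !a.2)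
  · intro s
    refine ⟨convex_univ, fun x _ y _ p r hp hr hpr => ?_⟩
    change (⨆ a, I a (p • x + r • y) s) ≤ p • (⨆ a, I a x s) + r • ⨆ a, I a y s
    refine ciSup_le fun a => ?_
    refine ((hIconv a s).2 (Set.mem_univ x) (Set.mem_univ y) hp hr hpr).trans ?_
    simp only [smul_eq_mul]
    exact add_le_add (mul_le_mul_of_nonneg_left (le_ciSup (hbdd x s) a) hp)
      (mul_le_mul_of_nonneg_left (le_ciSup (hbdd y s) a) hr)
  · intro s
    change Tendsto (fun x => (⨆ a, I a x s) - x) atTop (𝓝 0)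
    have h1 : Tendsto (fun x => ∑ a, (I a x s - x)) atTop (𝓝 0) := by
      have := tendsto_finsetSum (Finset.univ : Finset (Fin d × Bool)) fun a _ => hIlim a s
      simpa only [Finset.sum_const_zero] using this
    have hnn : ∀ a x, 0 ≤ I a x s - x := fun a x => by
      linarith [hIlow a x s, le_abs_self x]
    refine tendsto_of_tendsto_of_tendsto_of_le_of_le tendsto_const_nhds h1 ?_ ?_
    · intro x
      have := (hnn (Classical.arbitrary _) x)
      have h2 := le_ciSup (hbdd x s) (Classical.arbitrary _)
      simp only at h2 ⊢
      linarith
    · intro x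
      have : (⨆ a, I a x s) ≤ x + ∑ a, (I a x s - x) := ciSup_le fun a => by
        have := Finset.single_le_sum (f := fun a => I a x s - x) (fun a _ => hnn a x)
          (Finset.mem_univ a)
        linarith
      linarith

theorem goodValue_passport (d : ℕ) (hd : 0 < d) (σ : Fin d → ℝ)
    (Δt : ℕ → ℝ) (hΔt : ∀ n, 0 < Δt n) (N m : ℕ) :
    ∃ C, GoodValue d (passportValue d σ Δt N m) C := by
  induction m with
  | zero =>
    refine ⟨0, ?_, ?_, ?_, ?_, ?_, ?_⟩
    · simp only [passportValue]; exact (continuous_abs.measurable).comp measurable_fst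
    · intro x s; simp [passportValue]
    · intro x s; simp [passportValue]
    · intro x s; simp [passportValue]
    · intro s
      simp only [passportValue]
      exact convexOn_univ_norm (E := ℝ)
    · intro s
      refine tendsto_const_nhds.congr' ?_
      filter_upwards [eventually_ge_atTop 0] with x hx
      simp [passportValue, abs_of_nonneg hx]
  | succ m ih =>
    obtain ⟨C, hC⟩ := ih
    exact ⟨C + 2, hC.step hd σ (Δt (N - m)) (hΔt _)⟩

theorem statement_4
    (d : ℕ) (hd : 0 < d) (σ : Fin d → ℝ) (hσ : ∀ i, 0 < σ i)
    (Δt : ℕ → ℝ) (hΔt : ∀ n, 0 < Δt n) (N k : ℕ) (hk : k ≤ N)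
    (s : Fin d → ℝ) (hs : ∀ i, 0 < s i) :
    ∃ μ : Measure ℝ, IsProbabilityMeasure μ ∧ μ (Set.Iio 0) = 0 ∧
      ∀ y : ℝ, passportValue d σ Δt N (N - k) y s = ∫ z, max |y| z ∂μ := by
  obtain ⟨C, hC⟩ := goodValue_passport d hd σ Δt hΔt N (N - k)
  exact hockey_stick_mixture (fun x => passportValue d σ Δt N (N - k) x s) (hC.conv s)
    (fun x => hC.even x s) (hC.lim s)
end
end

section
/- (Going against the sign of the portfolio value dominates pointwise.) Let x ∈ ℝ with x ≠ 0, let s, σ, Δt > 0, S = S(s, σ, Δt), κ := (|x| + s)/s and κ̃ := (|x| − s)/s. Define φ₋(z) := E[max{|κS − s|, z}] and φ₊(z) := E[max{|κ̃S + s|, z}] for z ≥ 0. Then φ₊(z) ≤ φ₋(z) for every z ≥ 0; consequently, for every probability measure μ on [0,∞), max{∫φ₊ dμ, ∫φ₋ dμ} = ∫φ₋ dμ. -/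
open MeasureTheory ProbabilityTheory Real Filter

noncomputable section

/-- The lognormal asset price `S(s, σ, Δt) = s · exp(−σ²Δt/2 + σ√Δt · Z)` as a function of the
standard normal noise `z`; expectations `E[f(S)]` are integrals of `z ↦ f (lnPrice s σ Δt z)`
against the standard Gaussian measure `gaussianReal 0 1`. -/
def lnPrice (s σ Δt z : ℝ) : ℝ := s * Real.exp (-σ ^ 2 * Δt / 2 + σ * Real.sqrt Δt * z)

/-- Two-point inequality, homogeneous form. -/
lemma two_point_aux (y s z t u : ℝ) (hy : 0 ≤ y) (hs : 0 < s) (hz : 0 ≤ z) (ht : 0 ≤ t)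
    (htu : t ≤ u) :
    max |(y - s) * u + s * t| (t * z) + max |(y - s) * t + s * u| (u * z)
      ≤ max |(y + s) * u - s * t| (t * z) + max |(y + s) * t - s * u| (u * z) := by
  have e1 : (y - s) * u + s * t = y * u - s * (u - t) := by ring
  have e2 : (y - s) * t + s * u = y * t + s * (u - t) := by ring
  have e3 : (y + s) * u - s * t = y * u + s * (u - t) := by ring
  have e4 : (y + s) * t - s * u = y * t - s * (u - t) := by ring
  rw [e1, e2, e3, e4]
  have hd : 0 ≤ s * (u - t) := mul_nonneg hs.le (by linarith)
  have hyt : 0 ≤ y * t := mul_nonneg hy ht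
  have hyu : y * t ≤ y * u := mul_le_mul_of_nonneg_left htu hy
  have hzt : t * z ≤ u * z := mul_le_mul_of_nonneg_right htu hz
  have hzt0 : 0 ≤ t * z := mul_nonneg ht hz
  generalize s * (u - t) = d at *
  generalize y * t = a at *
  generalize y * u = b at *
  generalize t * z = p at *
  generalize u * z = q at *
  rw [abs_of_nonneg (by linarith : 0 ≤ a + d), abs_of_nonneg (by linarith : 0 ≤ b + d)]
  rcases abs_cases (b - d) with h1 | h1 <;> rcases abs_cases (a - d) with h2 | h2 <;>
  rcases max_cases |b - d| p with h3 | h3 <;> rcases max_cases (a + d) q with h4 | h4 <;>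
  rcases max_cases (b + d) p with h5 | h5 <;> rcases max_cases |a - d| q with h6 | h6 <;>
  linarith

lemma two_point (y s z u : ℝ) (hy : 0 ≤ y) (hs : 0 < s) (hz : 0 ≤ z) (hu : 0 < u) :
    max |(y - s) * u + s| z + max |(y - s) + s * u| (u * z)
      ≤ max |(y + s) * u + -s| z + max |(y + s) + -s * u| (u * z) := by
  rcases le_total 1 u with h | h
  · have := two_point_aux y s z 1 u hy hs hz zero_le_one h
    simpa [sub_eq_add_neg] using this
  · have := two_point_aux y s z u 1 hy hs hz hu.le h
    simp only [mul_one, one_mul] at this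
    have e : (y + s) * u + -s = (y + s) * u - s := by ring
    have e' : (y + s) + -s * u = (y + s) - s * u := by ring
    rw [e, e']
    linarith

/-- Symmetry of the lognormal law under change of numeraire. -/
lemma lognormal_symm (v a b z : ℝ) :
    ∫ w, max |a * exp (-v ^ 2 / 2 + v * w) + b| z ∂(gaussianReal 0 1)
      = ∫ w, max |a + b * exp (-v ^ 2 / 2 + v * w)| (exp (-v ^ 2 / 2 + v * w) * z)
          ∂(gaussianReal 0 1) := by
  rw [integral_gaussianReal_eq_integral_smul one_ne_zero,
    integral_gaussianReal_eq_integral_smul one_ne_zero,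
    ← integral_sub_left_eq_self _ volume v]
  congr 1
  ext w
  simp only [gaussianPDFReal, smul_eq_mul, NNReal.coe_one, mul_one, sub_zero]
  have h1 : exp (-(v - w) ^ 2 / 2) = exp (-w ^ 2 / 2) * exp (-v ^ 2 / 2 + v * w) := by
    rw [← exp_add]; congr 1; ring
  have h2 : exp (-v ^ 2 / 2 + v * w) * exp (-v ^ 2 / 2 + v * (v - w)) = 1 := by
    rw [← exp_add, ← exp_zero]; congr 1; ring
  rw [h1]
  have hpos := exp_pos (-v ^ 2 / 2 + v * w)
  generalize exp (-v ^ 2 / 2 + v * w) = e at *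
  generalize exp (-v ^ 2 / 2 + v * (v - w)) = r at *
  have h3 : e * max |a * r + b| z = max |a + b * e| (e * z) := by
    rw [mul_max_of_nonneg _ _ hpos.le]
    congr 1
    conv_lhs => rw [← abs_of_pos hpos]
    rw [← abs_mul]
    congr 1
    linear_combination a * h2
  rw [← h3]
  ring

lemma exp_integrable (v : ℝ) :
    Integrable (fun w => exp (-v ^ 2 / 2 + v * w)) (gaussianReal 0 1) := by
  simp_rw [exp_add]
  exact (integrable_exp_mul_gaussianReal v).const_mul _

lemma key_ineq (v y s z : ℝ) (hy : 0 ≤ y) (hs : 0 < s) (hz : 0 ≤ z) :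
    ∫ w, max |(y - s) * exp (-v ^ 2 / 2 + v * w) + s| z ∂(gaussianReal 0 1)
      ≤ ∫ w, max |(y + s) * exp (-v ^ 2 / 2 + v * w) + -s| z ∂(gaussianReal 0 1) := by
  have hi := exp_integrable v
  have A : ∀ a b : ℝ, Integrable (fun w => max |a * exp (-v ^ 2 / 2 + v * w) + b| z)
      (gaussianReal 0 1) := fun a b =>
    ((hi.const_mul a).add (integrable_const b)).abs.sup (integrable_const z)
  have B : ∀ a b : ℝ, Integrable (fun w => max |a + b * exp (-v ^ 2 / 2 + v * w)|
      (exp (-v ^ 2 / 2 + v * w) * z)) (gaussianReal 0 1) := fun a b =>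
    ((integrable_const a).add (hi.const_mul b)).abs.sup (hi.mul_const z)
  have h := integral_mono ((A (y - s) s).add (B (y - s) s)) ((A (y + s) (-s)).add (B (y + s) (-s)))
    (fun w => two_point y s z (exp (-v ^ 2 / 2 + v * w)) hy hs hz (exp_pos _))
  rw [integral_add' (A _ _) (B _ _), integral_add' (A _ _) (B _ _), ← lognormal_symm,
    ← lognormal_symm] at h
  linarith

/-- Going against the sign of the portfolio value dominates pointwise: with `κ = (|x| + s)/s`,
`κ̃ = (|x| − s)/s`, `φ₋(z) = E[max{|κS − s|, z}]` and `φ₊(z) = E[max{|κ̃S + s|, z}]`,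
one has `φ₊(z) ≤ φ₋(z)` for all `z ≥ 0`; consequently, for every probability measure `μ`
on `[0,∞)`, `max{∫φ₊ dμ, ∫φ₋ dμ} = ∫φ₋ dμ`. -/
theorem statement_12
    (x s σ Δt : ℝ) (hx : x ≠ 0) (hs : 0 < s) (hσ : 0 < σ) (hΔt : 0 < Δt)
    (κ κt : ℝ) (hκ : κ = (|x| + s) / s) (hκt : κt = (|x| - s) / s)
    (φm φp : ℝ → ℝ)
    (hφm : ∀ z, φm z = ∫ w, max |κ * lnPrice s σ Δt w - s| z ∂(gaussianReal 0 1))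
    (hφp : ∀ z, φp z = ∫ w, max |κt * lnPrice s σ Δt w + s| z ∂(gaussianReal 0 1)) :
    (∀ z, 0 ≤ z → φp z ≤ φm z)
    ∧ ∀ μ : Measure ℝ, IsProbabilityMeasure μ → μ (Set.Iio 0) = 0 →
        max (∫⁻ z, ENNReal.ofReal (φp z) ∂μ) (∫⁻ z, ENNReal.ofReal (φm z) ∂μ)
          = ∫⁻ z, ENNReal.ofReal (φm z) ∂μ := by
  have main : ∀ z, 0 ≤ z → φp z ≤ φm z := by
    intro z hz
    have h := key_ineq (σ * √Δt) |x| s z (abs_nonneg x) hs hz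
    have hv : (σ * √Δt) ^ 2 = σ ^ 2 * Δt := by rw [mul_pow, Real.sq_sqrt hΔt.le]
    rw [hφp, hφm]
    convert h using 5 with w w
    · rw [hκt, lnPrice, hv]
      field_simp
    · rw [hκ, lnPrice, hv, ← sub_eq_add_neg]
      field_simp
  refine ⟨main, fun μ _ hμ => max_eq_right (lintegral_mono_ae ?_)⟩
  have h0 : ∀ᵐ z ∂μ, z ∉ Set.Iio (0 : ℝ) := measure_eq_zero_iff_ae_notMem.mp hμ
  filter_upwards [h0] with z hz
  exact ENNReal.ofReal_le_ofReal (main z (not_lt.mp hz))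
end
end
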